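/- Let C be a regular category with a fixed class 𝒵 of zero objects. Let 𝓕 be a full, replete, reflective subcategory of C with reflector F and unit η such that: every component η_A is a 𝒵-cokernel of some morphism; every object Z of 𝒵 belongs to 𝓕 with F(Z) = Z; and for every morphism f : A ⟶ F(B) between objects of 𝓕 which is inverted by Z, the image under F of the pullback f*(η_B) of η_B along f is an isomorphism. Then, taking 𝒯 = { T | T is isomorphic to K[η_X] for some object X }, the pair (𝒯, 𝓕) is a 𝒵-torsion theory on C satisfying Condition (M'), with 𝒯 ∩ 𝓕 = 𝒵. -/

import Mathlib

open CategoryTheory CategoryTheory.Limits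

universe v u

/-- A class of zero objects in a category `C`: a collection of objects, closed under
isomorphism, such that every object has a zero part (a monomorphism from a zero object),
there is at most one morphism out of each zero object, and every morphism from a zero
object factors uniquely through any monic zero subobject of its codomain. -/
structure ZeroClass (C : Type u) [Category.{v} C] where
  carrier : Set C
  repl : ∀ {A B : C}, A ∈ carrier → (A ≅ B) → B ∈ carrier
  zpart : C → C
  zpart_mem : ∀ A : C, zpart A ∈ carrier
  ε : ∀ A : C, zpart A ⟶ A
  ε_mono : ∀ A : C, Mono (ε A)
  hom_unique : ∀ {Z A : C}, Z ∈ carrier → ∀ f g : Z ⟶ A, f = g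
  lift : ∀ {Z Z' A : C} (z : Z ⟶ A) (z' : Z' ⟶ A), Z ∈ carrier → Z' ∈ carrier → Mono z →
    ∃! φ : Z' ⟶ Z, φ ≫ z = z'

variable {C : Type u} [Category.{v} C]

/-- The ideal `N_𝒵` of morphisms factoring through a zero object. -/
def InIdeal (zc : ZeroClass C) {A B : C} (f : A ⟶ B) : Prop :=
  ∃ (W : C) (g : A ⟶ W) (h : W ⟶ B), W ∈ zc.carrier ∧ g ≫ h = f

/-- `k` is a `𝒵`-kernel of `f`. -/
def IsZKernel (zc : ZeroClass C) {K A B : C} (k : K ⟶ A) (f : A ⟶ B) : Prop :=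
  InIdeal zc (k ≫ f) ∧ ∀ {E : C} (e : E ⟶ A), InIdeal zc (e ≫ f) → ∃! φ : E ⟶ K, φ ≫ k = e

/-- `q` is a `𝒵`-cokernel of `f`. -/
def IsZCokernel (zc : ZeroClass C) {A B Q : C} (q : B ⟶ Q) (f : A ⟶ B) : Prop :=
  InIdeal zc (f ≫ q) ∧ ∀ {P : C} (p : B ⟶ P), InIdeal zc (f ≫ p) → ∃! φ : Q ⟶ P, q ≫ φ = p

/-- `x : X ⟶ M` is a maximum quotient of `X` in `𝒵`. -/
def IsMaxQuotient (zc : ZeroClass C) {X M : C} (x : X ⟶ M) : Prop :=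
  M ∈ zc.carrier ∧ ∀ {Z : C} (z : X ⟶ Z), Z ∈ zc.carrier → ∃ φ : M ⟶ Z, x ≫ φ = z

/-- A morphism is inverted by the zero-part functor `Z` if the induced morphism between
zero parts is an isomorphism. -/
def InvertedByZ (zc : ZeroClass C) {A B : C} (h : A ⟶ B) : Prop :=
  ∃ φ : zc.zpart A ⟶ zc.zpart B, φ ≫ zc.ε B = zc.ε A ≫ h ∧ IsIso φ

/-- A `𝒵`-torsion theory, with chosen short `𝒵`-exact sequences. -/
structure ZTorsionTheory (zc : ZeroClass C) where
  tors : Set C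
  torsFree : Set C
  tors_repl : ∀ {A B : C}, A ∈ tors → (A ≅ B) → B ∈ tors
  torsFree_repl : ∀ {A B : C}, A ∈ torsFree → (A ≅ B) → B ∈ torsFree
  inter : zc.carrier = tors ∩ torsFree
  hom_triv : ∀ {T F : C}, T ∈ tors → F ∈ torsFree → ∀ f : T ⟶ F, InIdeal zc f
  tObj : C → C
  fObj : C → C
  tMem : ∀ A : C, tObj A ∈ tors
  fMem : ∀ A : C, fObj A ∈ torsFree
  t : ∀ A : C, tObj A ⟶ A
  η : ∀ A : C, A ⟶ fObj A
  t_ker : ∀ A : C, IsZKernel zc (t A) (η A)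
  η_coker : ∀ A : C, IsZCokernel zc (η A) (t A)

/-- A class of morphisms of `C`. -/
def MorClass (C : Type u) [Category.{v} C] :=
  ∀ ⦃X Y : C⦄, (X ⟶ Y) → Prop

/-- A class of morphisms is replete (closed under isomorphism in the arrow category). -/
def Replete (E : MorClass C) : Prop :=
  ∀ {A B A' B' : C} (e : A ⟶ B) (e' : A' ⟶ B') (α : A ≅ A') (β : B ≅ B'),
    α.hom ≫ e' = e ≫ β.hom → E e → E e'

/-- The unique diagonal lifting property `e ↓ m`. -/
def UniqueLift {A B X Y : C} (e : A ⟶ B) (m : X ⟶ Y) : Prop :=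
  ∀ (u : A ⟶ X) (v : B ⟶ Y), e ≫ v = u ≫ m → ∃! d : B ⟶ X, e ≫ d = u ∧ d ≫ m = v

/-- A factorization system `(E, M)`. -/
structure IsFactorizationSystem (E M : MorClass C) : Prop where
  E_repl : Replete E
  M_repl : Replete M
  lift : ∀ {A B X Y : C} (e : A ⟶ B) (m : X ⟶ Y), E e → M m → UniqueLift e m
  fac : ∀ {A B : C} (f : A ⟶ B), ∃ (I : C) (e : A ⟶ I) (m : I ⟶ B), E e ∧ M m ∧ e ≫ m = f

/-- `E` is stable under pullback along morphisms of the class `A'`. -/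
def StableAlong (E A' : MorClass C) : Prop :=
  ∀ {P X Y W : C} (p : P ⟶ X) (e' : P ⟶ W) (e : X ⟶ Y) (a : W ⟶ Y),
    IsPullback p e' e a → E e → A' a → E e'

/-- Condition (N). -/
def CondN (zc : ZeroClass C) (tt : ZTorsionTheory zc) : Prop :=
  ∀ {A B K : C} (f : A ⟶ B) (k : K ⟶ A), IsZKernel zc k f →
    ∃ (Q : C) (q : A ⟶ Q), IsZKernel zc (tt.t K ≫ k) q

/-- Condition (M). -/
def CondM (zc : ZeroClass C) (tt : ZTorsionTheory zc) : Prop :=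
  ∀ {T A Q : C} (k : T ⟶ A) (q : A ⟶ Q), T ∈ tt.tors → IsZKernel zc k q →
    IsZCokernel zc q k → Nonempty (tt.fObj T ≅ zc.zpart Q)

/-- Condition (M'). -/
def CondM' (zc : ZeroClass C) (tt : ZTorsionTheory zc) : Prop :=
  ∀ A : C, Nonempty (tt.fObj (tt.tObj A) ≅ zc.zpart (tt.fObj A))

/-- Condition (S). -/
def CondS (zc : ZeroClass C) (tt : ZTorsionTheory zc) : Prop :=
  ∀ {T T' Z' : C} (χ : T' ⟶ Z') (l : T' ⟶ T) (z : Z' ⟶ tt.fObj T),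
    T ∈ tt.tors → Z' ∈ zc.carrier → IsPullback χ l z (tt.η T) →
    T' ∈ tt.tors ∧ IsZCokernel zc χ (𝟙 T')

/-- Condition (P): the reflector is `𝒵`-protoadditive, i.e. it preserves pullbacks of
split epimorphisms along morphisms inverted by `Z`. -/
def CondP (zc : ZeroClass C) (tt : ZTorsionTheory zc) : Prop :=
  ∀ {P A D B : C} (p₁ : P ⟶ A) (p₂ : P ⟶ D) (f : A ⟶ B) (g : D ⟶ B),
    (∃ s : B ⟶ A, s ≫ f = 𝟙 B) → InvertedByZ zc g → IsPullback p₁ p₂ f g →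
    ∀ (Fp₁ : tt.fObj P ⟶ tt.fObj A) (Fp₂ : tt.fObj P ⟶ tt.fObj D)
      (Ff : tt.fObj A ⟶ tt.fObj B) (Fg : tt.fObj D ⟶ tt.fObj B),
      tt.η P ≫ Fp₁ = p₁ ≫ tt.η A → tt.η P ≫ Fp₂ = p₂ ≫ tt.η D →
      tt.η A ≫ Ff = f ≫ tt.η B → tt.η D ≫ Fg = g ≫ tt.η B →
      IsPullback Fp₁ Fp₂ Ff Fg

/-- `h` is a trivial extension: the naturality square of the unit at `h` is a pullback. -/
def IsTrivialExt (zc : ZeroClass C) (tt : ZTorsionTheory zc) {X Y : C} (h : X ⟶ Y) : Prop :=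
  ∃ Fh : tt.fObj X ⟶ tt.fObj Y, tt.η X ≫ Fh = h ≫ tt.η Y ∧
    IsPullback (tt.η X) h Fh (tt.η Y)

/-- A full, replete, reflective subcategory, presented by its reflection data. -/
structure ReflectiveSub (C : Type u) [Category.{v} C] where
  carrier : Set C
  repl : ∀ {A B : C}, A ∈ carrier → (A ≅ B) → B ∈ carrier
  obj : C → C
  mem : ∀ A : C, obj A ∈ carrier
  η : ∀ A : C, A ⟶ obj A
  univ : ∀ {A W : C}, W ∈ carrier → ∀ g : A ⟶ W, ∃! g' : obj A ⟶ W, η A ≫ g' = g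

/-- The data exhibiting a class of zero objects as terminal. -/
structure TerminalData (zc : ZeroClass C) where
  V : C → C
  v : ∀ A : C, A ⟶ V A
  V_mem : ∀ A : C, V A ∈ zc.carrier
  fac : ∀ {A Z : C} (χ : A ⟶ Z), Z ∈ zc.carrier → ∃ φ : Z ⟶ V A, χ ≫ φ = v A

/-- A regular category: finite limits, coequalizers of kernel pairs, and pullback-stable
regular epimorphisms. -/
structure IsRegularCategory (C : Type u) [Category.{v} C] [HasFiniteLimits C] : Prop where
  kernelPair_coeq : ∀ {A B : C} (f : A ⟶ B),
    HasCoequalizer (pullback.fst f f) (pullback.snd f f)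
  regularEpi_stable : ∀ {X Y Z : C} (f : X ⟶ Z) (g : Y ⟶ Z),
    Nonempty (RegularEpi f) → Nonempty (RegularEpi (pullback.snd f g))

/-- A protomodular category. -/
structure IsProtomodular (C : Type u) [Category.{v} C] : Prop where
  hasSplitPullbacks : ∀ {A B X : C} (f : A ⟶ B) (p : X ⟶ B) (s : B ⟶ X),
    s ≫ p = 𝟙 B → HasPullback p f
  split_jointly_extremal : ∀ {A B X Y : C} (f : A ⟶ B) (p : X ⟶ B) (s : B ⟶ X)
      (q : Y ⟶ A) (t : A ⟶ Y) (g : Y ⟶ X),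
      s ≫ p = 𝟙 B → t ≫ q = 𝟙 A → IsPullback g q p f →
      ∀ {M : C} (m : M ⟶ X), Mono m → (∃ g' : Y ⟶ M, g' ≫ m = g) →
        (∃ s' : B ⟶ M, s' ≫ m = s) → IsIso m

/-- An internal equivalence relation given by a jointly monic pair. -/
structure IsEquivRelationPair {R A : C} (r₁ r₂ : R ⟶ A) : Prop where
  jointly_mono : ∀ {W : C} (f g : W ⟶ R), f ≫ r₁ = g ≫ r₁ → f ≫ r₂ = g ≫ r₂ → f = g
  refl : ∃ d : A ⟶ R, d ≫ r₁ = 𝟙 A ∧ d ≫ r₂ = 𝟙 A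
  symm : ∃ s : R ⟶ R, s ≫ r₁ = r₂ ∧ s ≫ r₂ = r₁
  trans : ∀ {W : C} (f g : W ⟶ R), f ≫ r₂ = g ≫ r₁ →
    ∃ h : W ⟶ R, h ≫ r₁ = f ≫ r₁ ∧ h ≫ r₂ = g ≫ r₂

/-- A Barr-exact category: regular and every internal equivalence relation is effective. -/
structure IsBarrExact (C : Type u) [Category.{v} C] [HasFiniteLimits C]
    extends IsRegularCategory C : Prop where
  equivRel_effective : ∀ {R A : C} (r₁ r₂ : R ⟶ A), IsEquivRelationPair r₁ r₂ →
    ∃ (B : C) (q : A ⟶ B), IsPullback r₁ r₂ q q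

namespace ZeroClass

variable (zc : ZeroClass C)

/-- Precomposing a morphism of the ideal stays in the ideal. -/
lemma inIdeal_precomp {A B D : C} (f : A ⟶ B) {g : B ⟶ D} (hg : InIdeal zc g) :
    InIdeal zc (f ≫ g) := by
  obtain ⟨W, a, b, hW, rfl⟩ := hg
  exact ⟨W, f ≫ a, b, hW, Category.assoc _ _ _⟩

/-- A morphism lies in the ideal iff it factors through the zero part of its codomain. -/
lemma inIdeal_iff_factors_ε {A B : C} (f : A ⟶ B) :
    InIdeal zc f ↔ ∃ c : A ⟶ zc.zpart B, c ≫ zc.ε B = f := by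
  constructor
  · rintro ⟨W, a, b, hW, rfl⟩
    obtain ⟨φ, hφ, -⟩ := zc.lift (zc.ε B) b (zc.zpart_mem B) hW (zc.ε_mono B)
    exact ⟨a ≫ φ, by rw [Category.assoc, hφ]⟩
  · rintro ⟨c, rfl⟩
    exact ⟨_, c, zc.ε B, zc.zpart_mem B, rfl⟩

/-- An object whose identity lies in the ideal is a zero object. -/
lemma mem_of_inIdeal_id {A : C} (h : InIdeal zc (𝟙 A)) : A ∈ zc.carrier := by
  obtain ⟨W, a, b, hW, hab⟩ := h
  exact zc.repl hW ⟨b, a, zc.hom_unique hW _ _, hab⟩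

/-- The inclusion of the zero part is inverted by the zero-part functor. -/
lemma invertedByZ_ε (B : C) : InvertedByZ zc (zc.ε B) := by
  have := zc.ε_mono (zc.zpart B)
  have hmem := zc.zpart_mem B
  obtain ⟨ψ, hψ, -⟩ := zc.lift (zc.ε (zc.zpart B)) (𝟙 _) (zc.zpart_mem _) hmem this
  exact ⟨zc.ε (zc.zpart B), rfl, ψ, zc.hom_unique (zc.zpart_mem _) _ _, hψ⟩

end ZeroClass

/-- The pullback of the zero part of `B` along `f` is a `𝒵`-kernel of `f`. -/
lemma IsZKernel.of_isPullback {zc : ZeroClass C} {K A B : C} {c : K ⟶ zc.zpart B} {k : K ⟶ A}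
    {f : A ⟶ B} (h : IsPullback c k (zc.ε B) f) : IsZKernel zc k f := by
  refine ⟨(zc.inIdeal_iff_factors_ε _).2 ⟨c, h.w⟩, fun {E} e he => ?_⟩
  obtain ⟨s, hs⟩ := (zc.inIdeal_iff_factors_ε _).1 he
  refine ⟨h.lift s e hs, h.lift_snd _ _ _, fun φ hφ => h.hom_ext ?_ ?_⟩
  · have := zc.ε_mono B
    rw [← cancel_mono (zc.ε B), h.lift_fst, hs, Category.assoc, h.w, ← Category.assoc, hφ]
  · rw [h.lift_snd, hφ]

/-- A `𝒵`-kernel of `f : A ⟶ B` is a pullback of the zero part of `B` along `f`. -/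
lemma IsZKernel.exists_isPullback {zc : ZeroClass C} {K A B : C} {k : K ⟶ A} {f : A ⟶ B}
    (h : IsZKernel zc k f) : ∃ c : K ⟶ zc.zpart B, IsPullback c k (zc.ε B) f := by
  have := zc.ε_mono B
  obtain ⟨c, hc⟩ := (zc.inIdeal_iff_factors_ε _).1 h.1
  refine ⟨c, ⟨hc⟩, ⟨PullbackCone.IsLimit.mk hc
    (fun s => (h.2 s.snd ((zc.inIdeal_iff_factors_ε _).2 ⟨s.fst, s.condition⟩)).choose)
    (fun s => ?_) (fun s => ?_) (fun s m _ hm => ?_)⟩⟩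
  · have hs := (h.2 s.snd ((zc.inIdeal_iff_factors_ε _).2 ⟨s.fst, s.condition⟩)).choose_spec.1
    dsimp only at hs
    rw [← cancel_mono (zc.ε B), Category.assoc, hc, ← Category.assoc, hs, s.condition]
  · exact (h.2 s.snd ((zc.inIdeal_iff_factors_ε _).2 ⟨s.fst, s.condition⟩)).choose_spec.1
  · exact (h.2 s.snd ((zc.inIdeal_iff_factors_ε _).2 ⟨s.fst, s.condition⟩)).choose_spec.2 m hm

/-- A `𝒵`-cokernel of some morphism is a `𝒵`-cokernel of any of its `𝒵`-kernels. -/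
lemma IsZCokernel.of_isZKernel {zc : ZeroClass C} {W A Q K : C} {q : A ⟶ Q} {g : W ⟶ A}
    {k : K ⟶ A} (hq : IsZCokernel zc q g) (hk : IsZKernel zc k q) : IsZCokernel zc q k := by
  refine ⟨hk.1, fun {P} p hp => hq.2 p ?_⟩
  obtain ⟨φ, rfl, -⟩ := hk.2 g hq.1
  rw [Category.assoc]
  exact zc.inIdeal_precomp φ hp

/-- a full, replete, reflective subcategory `𝓕` of a regular category,
whose units are `𝒵`-cokernels, which contains `𝒵` with `F(Z) = Z`, and such that `F`
inverts the pullback of a unit along any morphism of `𝓕` inverted by `Z`, is the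
torsion-free part of a `𝒵`-torsion theory satisfying Condition (M'), with torsion part
the closure under isomorphism of the `𝒵`-kernels of the units. -/
theorem reflection_gives_torsionTheory [HasFiniteLimits C]
    (hreg : IsRegularCategory C) (zc : ZeroClass C) (R : ReflectiveSub C)
    (hcoker : ∀ A : C, ∃ (W : C) (g : W ⟶ A), IsZCokernel zc (R.η A) g)
    (hZ : ∀ Z ∈ zc.carrier, R.obj Z = Z)
    (hstable : ∀ {A B : C} (f : A ⟶ R.obj B), A ∈ R.carrier → InvertedByZ zc f →
      ∀ {P : C} (f'' : P ⟶ A) (f' : P ⟶ B), IsPullback f'' f' f (R.η B) →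
        ∀ φ : R.obj P ⟶ R.obj A, R.η P ≫ φ = f'' ≫ R.η A → IsIso φ) :
    ∃ tt : ZTorsionTheory zc,
      tt.torsFree = R.carrier ∧
      tt.tors = {T : C | ∃ (X K : C) (k : K ⟶ X),
        IsZKernel zc k (R.η X) ∧ Nonempty (T ≅ K)} ∧
      CondM' zc tt := by
  have hZmem : ∀ Z ∈ zc.carrier, Z ∈ R.carrier := fun Z h => hZ Z h ▸ R.mem Z
  have hiso : ∀ {X K : C} (k : K ⟶ X), IsZKernel zc k (R.η X) →
      Nonempty (R.obj K ≅ zc.zpart (R.obj X)) := by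
    intro X K k hk
    obtain ⟨c, hc⟩ := hk.exists_isPullback
    obtain ⟨φ, hφ, -⟩ := R.univ (R.mem (zc.zpart (R.obj X))) (c ≫ R.η _)
    have := hstable (zc.ε (R.obj X)) (hZmem _ (zc.zpart_mem _)) (zc.invertedByZ_ε _) c k hc φ hφ
    exact ⟨asIso φ ≪≫ eqToIso (hZ _ (zc.zpart_mem _))⟩
  have htriv : ∀ {T F : C}, (∃ (X K : C) (k : K ⟶ X),
      IsZKernel zc k (R.η X) ∧ Nonempty (T ≅ K)) → F ∈ R.carrier →
      ∀ f : T ⟶ F, InIdeal zc f := by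
    rintro T F ⟨X, K, k, hk, ⟨i⟩⟩ hF f
    obtain ⟨e⟩ := hiso k hk
    obtain ⟨g, hg, -⟩ := R.univ hF (i.inv ≫ f)
    exact ⟨R.obj K, i.hom ≫ R.η K, g, zc.repl (zc.zpart_mem _) e.symm, by simp [hg]⟩
  have hker : ∀ A : C, IsZKernel zc (pullback.snd (zc.ε (R.obj A)) (R.η A)) (R.η A) :=
    fun A => .of_isPullback (IsPullback.of_hasPullback _ _)
  refine ⟨{
    tors := {T : C | ∃ (X K : C) (k : K ⟶ X), IsZKernel zc k (R.η X) ∧ Nonempty (T ≅ K)}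
    torsFree := R.carrier
    tors_repl := by
      rintro A B ⟨X, K, k, hk, ⟨i⟩⟩ e
      exact ⟨X, K, k, hk, ⟨e.symm ≪≫ i⟩⟩
    torsFree_repl := R.repl
    inter := by
      ext A
      refine ⟨fun hA => ⟨⟨A, A, 𝟙 A, ⟨⟨A, 𝟙 A, R.η A, hA, rfl⟩, fun e _ => ?_⟩,
        ⟨Iso.refl A⟩⟩, hZmem A hA⟩, fun hA => zc.mem_of_inIdeal_id (htriv hA.1 hA.2 _)⟩
      exact ⟨e, by simp, fun φ hφ => by simpa using hφ⟩
    hom_triv := htriv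
    tObj := fun A => pullback (zc.ε (R.obj A)) (R.η A)
    fObj := R.obj
    tMem := fun A => ⟨A, _, _, hker A, ⟨Iso.refl _⟩⟩
    fMem := R.mem
    t := fun A => pullback.snd _ _
    η := R.η
    t_ker := hker
    η_coker := fun A => (hcoker A).choose_spec.choose_spec.of_isZKernel (hker A) },
    rfl, rfl, fun A => hiso _ (hker A)⟩
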